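/- Let n be a positive integer and let S be a sequence of n elements of ℤ/nℤ. Then S contains a nonempty zero-sum subsequence T (the sum of the terms of T is 0 in ℤ/nℤ) with length |T| ∈ [1, h(S)]. -/

import Mathlib

/-- `h(S)`: the maximal multiplicity of an element occurring in `S`. -/
def maxRep {α : Type*} [DecidableEq α] (S : Multiset α) : ℕ :=
  S.toFinset.sup fun a => S.count a

open scoped Pointwise in
/-- Scherk's theorem in finite abelian groups. -/
theorem scherk_aux {G : Type*} [AddCommGroup G] [Finite G] [DecidableEq G] (k : ℕ) :
    ∀ (A B : Finset G), B.card = k → 0 ∈ A → 0 ∈ B →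
      (∀ a ∈ A, ∀ b ∈ B, a + b = 0 → b = 0) → A.card + B.card ≤ (A + B).card + 1 := by
  induction k using Nat.strong_induction_on with
  | _ k ih =>
  intro A B hk hA hB hu
  by_cases hst : ∀ a ∈ A, ∀ b ∈ B, a + b ∈ A
  · have hB1 : B = {0} := by
      refine Finset.eq_singleton_iff_unique_mem.2 ⟨hB, fun b hb => ?_⟩
      have hmul : ∀ m : ℕ, m • b ∈ A := by
        intro m
        induction m with
        | zero => simpa using hA
        | succ m hm => rw [succ_nsmul]; exact hst _ hm _ hb
      apply hu ((addOrderOf b - 1) • b) (hmul _) b hb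
      rw [← succ_nsmul, Nat.sub_add_cancel (addOrderOf_pos b), addOrderOf_nsmul_eq_zero]
    subst hB1
    simp
  · push Not at hst
    obtain ⟨a, ha, b, hb, hab⟩ := hst
    set V : Finset G := B.image (fun x => a + x) with hV
    set B' : Finset G := B.filter (fun x => a + x ∈ A) with hB'
    have hVcard : V.card = B.card := Finset.card_image_of_injective _ (add_right_injective a)
    have hinter : (A ∩ V).card = B'.card := by
      have : A ∩ V = B'.image (fun x => a + x) := by
        ext x
        simp only [hV, hB', Finset.mem_inter, Finset.mem_image, Finset.mem_filter]
        constructor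
        · rintro ⟨h1, y, h2, rfl⟩; exact ⟨y, ⟨h2, h1⟩, rfl⟩
        · rintro ⟨y, ⟨h2, h1⟩, rfl⟩; exact ⟨h1, y, h2, rfl⟩
      rw [this]
      exact Finset.card_image_of_injective _ (add_right_injective a)
    have hcard := Finset.card_union_add_card_inter A V
    have hlt : B'.card < k := by
      rw [← hk]
      apply Finset.card_lt_card
      refine Finset.ssubset_iff_subset_ne.2 ⟨Finset.filter_subset _ _, fun h => ?_⟩
      rw [← h] at hb
      exact hab (Finset.mem_filter.1 hb).2
    have key := ih _ hlt (A ∪ V) B' rfl (Finset.mem_union_left _ hA)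
      (Finset.mem_filter.2 ⟨hB, by simpa using ha⟩) (by
        intro x hx y hy hxy
        obtain ⟨hy1, hy2⟩ := Finset.mem_filter.1 hy
        rcases Finset.mem_union.1 hx with hx | hx
        · exact hu x hx y hy1 hxy
        · obtain ⟨z, hz, rfl⟩ := Finset.mem_image.1 hx
          have hz0 : z = 0 := hu (a + y) hy2 z hz (by rw [← hxy]; abel)
          subst hz0
          exact hu a ha y hy1 (by simpa using hxy))
    have hsub : (A ∪ V) + B' ⊆ A + B := by
      intro x hx
      obtain ⟨u, hu', y, hy, rfl⟩ := Finset.mem_add.1 hx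
      obtain ⟨hy1, hy2⟩ := Finset.mem_filter.1 hy
      rcases Finset.mem_union.1 hu' with h | h
      · exact Finset.add_mem_add h hy1
      · obtain ⟨z, hz, rfl⟩ := Finset.mem_image.1 h
        exact Finset.mem_add.2 ⟨a + y, hy2, z, hz, by abel⟩
    have := Finset.card_le_card hsub
    omega

open scoped Pointwise in
/-- Without short zero-sum subsequences there are many short subsequence sums. -/
theorem sums_aux {G : Type*} [AddCommGroup G] [Finite G] [DecidableEq G] (h : ℕ) :
    ∀ (S : Multiset G), (∀ a, S.count a ≤ h) →
      (∀ T ≤ S, T.card ≤ h → T.sum = 0 → T = 0) →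
      ∃ C : Finset G, (∀ c ∈ C, ∃ T ≤ S, T.card ≤ h ∧ T.sum = c) ∧ 0 ∈ C ∧
        S.card + 1 ≤ C.card := by
  induction h with
  | zero =>
    intro S hS _
    have : S = 0 := Multiset.eq_zero_of_forall_notMem fun a ha => by
      have := Multiset.count_pos.2 ha
      have := hS a
      omega
    subst this
    exact ⟨{0}, by simp, by simp, by simp⟩
  | succ h ih =>
    intro S hS hz
    have hle : S.dedup ≤ S := Multiset.dedup_le S
    have hadd : S - S.dedup + S.dedup = S := Multiset.sub_add_cancel hle
    obtain ⟨C, hC, hC0, hCc⟩ := ih (S - S.dedup) (by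
        intro a
        rw [Multiset.count_sub, Multiset.count_dedup]
        have := hS a
        split_ifs with hm
        · omega
        · rw [Multiset.count_eq_zero_of_notMem hm]; omega)
      (fun T hT hc hs => hz T (hT.trans (Multiset.sub_le_self _ _)) (by omega) hs)
    have hext : ∀ T ≤ S - S.dedup, ∀ b ∈ S, b ::ₘ T ≤ S := by
      intro T hT b hb
      have h1 : ({b} : Multiset G) ≤ S.dedup :=
        Multiset.singleton_le.2 (Multiset.mem_dedup.2 hb)
      calc b ::ₘ T = T + {b} := by rw [add_comm, Multiset.singleton_add]
        _ ≤ S - S.dedup + S.dedup := add_le_add hT h1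
        _ = S := hadd
    have h0 : (0 : G) ∉ S.toFinset := by
      intro hm
      have := hz {0} (Multiset.singleton_le.2 (Multiset.mem_toFinset.1 hm)) (by simp) (by simp)
      simp at this
    refine ⟨C + insert 0 S.toFinset, ?_, ?_, ?_⟩
    · intro x hx
      obtain ⟨c, hc, b, hb, rfl⟩ := Finset.mem_add.1 hx
      obtain ⟨T, hT, hTc, rfl⟩ := hC c hc
      rcases Finset.mem_insert.1 hb with rfl | hb
      · exact ⟨T, hT.trans (Multiset.sub_le_self _ _), by omega, by simp⟩
      · exact ⟨b ::ₘ T, hext T hT b (Multiset.mem_toFinset.1 hb), by simpa using hTc,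
          by rw [Multiset.sum_cons, add_comm]⟩
    · exact Finset.mem_add.2 ⟨0, hC0, 0, Finset.mem_insert_self _ _, by simp⟩
    · have key := scherk_aux _ C (insert 0 S.toFinset) rfl hC0 (Finset.mem_insert_self _ _) (by
        intro c hc b hb hcb
        rcases Finset.mem_insert.1 hb with hb | hb
        · exact hb
        · obtain ⟨T, hT, hTc, rfl⟩ := hC c hc
          have := hz (b ::ₘ T) (hext T hT b (Multiset.mem_toFinset.1 hb)) (by simpa using hTc)
            (by rw [Multiset.sum_cons, add_comm, hcb])
          simp at this)
      rw [Finset.card_insert_of_notMem h0] at key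
      have h2 : (S - S.dedup).card + S.dedup.card = S.card := by
        rw [← Multiset.card_add, hadd]
      have h3 : S.toFinset.card = S.dedup.card := rfl
      omega

/-- Lemma 3.1 (Alon): every sequence of `n` elements of `ℤ/nℤ` contains a
nonempty zero-sum subsequence `T` with `1 ≤ |T| ≤ h(S)`. -/
theorem stmt_4 (n : ℕ) (hn : 0 < n) (S : Multiset (ZMod n))
    (hcard : Multiset.card S = n) :
    ∃ T ≤ S, T ≠ 0 ∧ Multiset.card T ≤ maxRep S ∧ T.sum = 0 := by
  haveI : NeZero n := ⟨hn.ne'⟩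
  by_contra hcon
  push Not at hcon
  obtain ⟨C, -, -, hC⟩ := sums_aux (maxRep S) S (by
      intro a
      by_cases ha : a ∈ S
      · exact Finset.le_sup (f := fun a => S.count a) (Multiset.mem_toFinset.2 ha)
      · rw [Multiset.count_eq_zero_of_notMem ha]; omega)
    (fun T hT hc hs => by
      by_contra hne
      exact hcon T hT hne hc hs)
  have h1 := Finset.card_le_univ C
  rw [ZMod.card] at h1
  omega
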